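/- arXiv:2406.05095 — 4 statements merged into one kernel-verified Lean document; each statement's English description precedes it below -/
import Mathlib

section
/- Let G be a loopless multigraph and F : V(G) → finite sets of naturals with |F(v)| < d(v)/2 for all v. If G has no F-avoiding orientation and |E(G)| is minimum among such counterexamples, then for every pair of adjacent vertices u, v, either 0 ∉ F(u) or d_G(v) ∉ F(v). -/
attribute [local instance] Classical.propDecidable

/-- A loopless multigraph: edges indexed by `E` with endpoints in `Sym2 V`. -/
structure Multigraph (V E : Type) where
  ends : E → Sym2 V
  loopless : ∀ e, ¬ (ends e).IsDiag

namespace Multigraph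

variable {V E : Type}

/-- Degree of a vertex: number of edges incident to it. -/
noncomputable def deg [Fintype E] (G : Multigraph V E) (v : V) : ℕ :=
  (Finset.univ.filter fun e => v ∈ G.ends e).card

/-- Two vertices are adjacent if some edge joins them. -/
def Adj (G : Multigraph V E) (u v : V) : Prop :=
  u ≠ v ∧ ∃ e, G.ends e = s(u, v)

/-- An orientation assigns a tail and head to each edge, consistent with its endpoints. -/
structure Orientation (G : Multigraph V E) where
  tail : E → V
  head : E → V
  consistent : ∀ e, G.ends e = s(tail e, head e)

/-- Out-degree of a vertex in an orientation. -/
noncomputable def Orientation.outDeg [Fintype E] {G : Multigraph V E} (D : G.Orientation)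
    (v : V) : ℕ :=
  (Finset.univ.filter fun e => D.tail e = v).card

/-- An orientation is `F`-avoiding if no vertex has out-degree in its forbidden list. -/
def Orientation.Avoids [Fintype E] {G : Multigraph V E} (D : G.Orientation)
    (F : V → Finset ℕ) : Prop :=
  ∀ v, D.outDeg v ∉ F v

/-- Number of edges with both endpoints in `S`. -/
noncomputable def eIn [Fintype E] (G : Multigraph V E) (S : Finset V) : ℕ :=
  (Finset.univ.filter fun e => ∀ w ∈ G.ends e, w ∈ S).card

/-- Number of edges with exactly one endpoint in `S`. -/
noncomputable def cut [Fintype E] (G : Multigraph V E) (S : Finset V) : ℕ :=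
  (Finset.univ.filter fun e => (∃ w ∈ G.ends e, w ∈ S) ∧ ¬ ∀ w ∈ G.ends e, w ∈ S).card

/-- Reachability by directed paths in an orientation. -/
def Orientation.Reach {G : Multigraph V E} (D : G.Orientation) : V → V → Prop :=
  Relation.ReflTransGen fun a b => ∃ e, D.tail e = a ∧ D.head e = b

end Multigraph

theorem Fintype.card_filter_eq_add_card_filter_ne {E : Type} [Fintype E] (p : E → Prop) (e : E) :
    (Finset.univ.filter p).card =
      (if p e then 1 else 0) + (Finset.univ.filter fun x : {x // x ≠ e} => p x).card := by
  rw [Finset.card_filter, Finset.card_filter, Fintype.sum_eq_add_sum_subtype_ne _ e]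

namespace Multigraph

variable {V E : Type}

/-- The multigraph obtained by deleting the edge `e`. -/
def deleteEdge (G : Multigraph V E) (e : E) : Multigraph V {x // x ≠ e} where
  ends x := G.ends x
  loopless x := G.loopless x

theorem deg_eq_add_deg_deleteEdge [Fintype E] (G : Multigraph V E) (e : E) (w : V) :
    G.deg w = (if w ∈ G.ends e then 1 else 0) + (G.deleteEdge e).deg w := by
  unfold deg
  convert Fintype.card_filter_eq_add_card_filter_ne (fun x => w ∈ G.ends x) e
  rfl

theorem Orientation.outDeg_le_deg [Fintype E] {G : Multigraph V E} (D : G.Orientation) (w : V) :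
    D.outDeg w ≤ G.deg w := by
  refine Finset.card_le_card (Finset.monotone_filter_right _ fun x _ hx => ?_)
  rw [D.consistent, ← hx]
  exact Sym2.mem_mk_left _ _

/-- Extend an orientation of `G.deleteEdge e` by directing `e` from `u` to `v`. -/
noncomputable def Orientation.extend {G : Multigraph V E} {e : E} {u v : V}
    (D : (G.deleteEdge e).Orientation) (he : G.ends e = s(u, v)) : G.Orientation where
  tail x := if h : x = e then u else D.tail ⟨x, h⟩
  head x := if h : x = e then v else D.head ⟨x, h⟩
  consistent x := by
    by_cases h : x = e
    · simp [h, he]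
    · simp only [h, dif_neg, not_false_eq_true]
      exact D.consistent ⟨x, h⟩

theorem Orientation.outDeg_extend [Fintype E] {G : Multigraph V E} {e : E} {u v : V}
    (D : (G.deleteEdge e).Orientation) (he : G.ends e = s(u, v)) (w : V) :
    (D.extend he).outDeg w = (if u = w then 1 else 0) + D.outDeg w := by
  unfold outDeg
  rw [Fintype.card_filter_eq_add_card_filter_ne _ e]
  have key : ∀ x : {x // x ≠ e}, (D.extend he).tail x = D.tail x := fun x => by
    simp [extend, x.2]
  have hu : (D.extend he).tail e = u := by simp [extend]
  simp only [key, hu]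

end Multigraph

theorem stmt2 {V E : Type} [Fintype E] (G : Multigraph V E) (F : V → Finset ℕ)
    (hF : ∀ v, 2 * (F v).card < G.deg v)
    (hno : ¬ ∃ D : G.Orientation, D.Avoids F)
    (hmin : ∀ (V' E' : Type) [Fintype E'] (G' : Multigraph V' E') (F' : V' → Finset ℕ),
      Fintype.card E' < Fintype.card E → (∀ v, 2 * (F' v).card < G'.deg v) →
      ∃ D : G'.Orientation, D.Avoids F') :
    ∀ u v : V, G.Adj u v → 0 ∉ F u ∨ G.deg v ∉ F v := by
  rintro u v ⟨huv, e, he⟩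
  by_contra! ⟨hu, hv⟩
  let F' : V → Finset ℕ := fun w =>
    if w = u then ((F u).erase 0).image Nat.pred
    else if w = v then (F v).erase (G.deg v) else F w
  obtain ⟨D, hD⟩ := hmin V {x // x ≠ e} (G.deleteEdge e) F'
    (Fintype.card_subtype_lt (x := e) (by simp)) (fun w => by
      have hw := hF w
      have hdeg := G.deg_eq_add_deg_deleteEdge e w
      simp only [he, Sym2.mem_iff] at hdeg
      by_cases h1 : w = u
      · subst h1
        have hc := Finset.card_erase_add_one hu
        have hi := Finset.card_image_le (s := (F w).erase 0) (f := Nat.pred)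
        simp only [F', if_true, true_or] at hdeg ⊢
        omega
      · by_cases h2 : w = v
        · subst h2
          have hc := Finset.card_erase_add_one hv
          simp only [F', h1, if_true, if_false, or_true] at hdeg ⊢
          omega
        · simp only [F', h1, h2, if_false, or_false] at hdeg ⊢
          omega)
  refine hno ⟨D.extend he, fun w hw => hD w ?_⟩
  rw [D.outDeg_extend he w] at hw
  by_cases h1 : w = u
  · subst h1
    simp only [F', if_true] at hw ⊢
    exact Finset.mem_image.2 ⟨_, Finset.mem_erase.2 ⟨by omega, hw⟩, by simp⟩
  · rw [if_neg (Ne.symm h1), zero_add] at hw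
    by_cases h2 : w = v
    · subst h2
      have hdeg := G.deg_eq_add_deg_deleteEdge e w
      have hle := D.outDeg_le_deg w
      simp only [he, Sym2.mem_iff, or_true, if_true] at hdeg
      simp only [F', h1, if_true, if_false]
      exact Finset.mem_erase.2 ⟨by omega, hw⟩
    · simpa only [F', h1, h2, if_false] using hw
end

section
/- For every F : V(K₆) → 2^ℕ with |F(v)| < 5/2 (i.e., |F(v)| ≤ 2) for all v, the graph obtained from K₆ by removing a perfect matching (or any matching of size at least 2) admits an F-avoiding orientation. -/
/-- The iterated difference of `f` at the origin along all the standard basis vectors. -/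
def iteratedDifference : (n : ℕ) → ((Fin n → ℤ) → ℤ) → ℤ
  | 0, f => f Fin.elim0
  | n + 1, f => iteratedDifference n (fun y => f (Fin.cons 1 y)) -
      iteratedDifference n (fun y => f (Fin.cons 0 y))

theorem iteratedDifference_eq_sum (n : ℕ) (f : (Fin n → ℤ) → ℤ) :
    iteratedDifference n f =
      ∑ x : Fin n → Bool, (∏ i, if x i then 1 else -1) * f (fun i => (x i).toInt) := by
  induction n with
  | zero =>
    rw [Fintype.sum_unique]
    simp only [iteratedDifference, Finset.univ_eq_empty, Finset.prod_empty, one_mul]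
    exact congrArg f (Subsingleton.elim _ _)
  | succ n ih =>
    have hcons (b : Bool) (x : Fin n → Bool) :
        (fun i => ((Fin.cons b x : Fin (n + 1) → Bool) i).toInt) =
          Fin.cons b.toInt (fun i => (x i).toInt) := by
      ext i
      refine Fin.cases ?_ (fun i => ?_) i <;> simp
    rw [← (Fin.consEquiv fun _ => Bool).sum_comp, Fintype.sum_prod_type]
    simp [iteratedDifference, ih, Fin.prod_univ_succ, Fin.consEquiv, sub_eq_add_neg, hcons]

/-- The alternating sum over a Boolean cube of a function that does not depend on one of the
coordinates vanishes. -/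
theorem sum_sign_mul_eq_zero_of_update {I : Type*} [Fintype I] [DecidableEq I] (i : I) (g : (I → Bool) → ℤ)
    (hg : ∀ x b, g (Function.update x i b) = g x) :
    ∑ x : I → Bool, (∏ k, if x k then (1 : ℤ) else -1) * g x = 0 := by
  refine Finset.sum_involution (fun x _ => Function.update x i (!x i)) ?_ ?_ ?_ ?_
  · intro x _
    rw [hg, ← add_mul, Fintype.prod_eq_mul_prod_compl i, Fintype.prod_eq_mul_prod_compl i]
    have h : ∏ k ∈ {i}ᶜ, (if Function.update x i (!x i) k = true then (1 : ℤ) else -1) =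
        ∏ k ∈ {i}ᶜ, if x k = true then (1 : ℤ) else -1 := by
      refine Finset.prod_congr rfl fun k hk => ?_
      rw [Function.update_of_ne (by simpa using hk)]
    rw [h, ← add_mul]
    cases hx : x i <;> simp
  · intro x _ _ h
    have := congrFun h i
    simp at this
  · intro x _
    exact Finset.mem_univ _
  · intro x _
    simp

/-- The alternating sum over a Boolean cube of a product of at most as many affine forms as there
are coordinates does not depend on the constant terms. -/
theorem sum_sign_mul_prod_affine_eq {I J : Type*} [Fintype I] [DecidableEq I] [Fintype J]
    [DecidableEq J] (h : Fintype.card J ≤ Fintype.card I) (M : J → I → ℤ) (c c' : J → ℤ) :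
    ∑ x : I → Bool, (∏ k, if x k then (1 : ℤ) else -1) *
        ∏ j, (c j + ∑ i, if x i then M j i else 0) =
      ∑ x : I → Bool, (∏ k, if x k then (1 : ℤ) else -1) *
        ∏ j, (c' j + ∑ i, if x i then M j i else 0) := by
  have expand (c : J → ℤ) (x : I → Bool) : ∏ j, (c j + ∑ i, if x i then M j i else 0) =
      ∑ f : J → Option I, (∏ j, (f j).elim (c j) (M j)) *
        ∏ j, if (f j).elim true x then 1 else 0 := by
    have (j : J) : (c j + ∑ i, if x i then M j i else 0) =
        ∑ o : Option I, o.elim (c j) (M j) * if o.elim true x then 1 else 0 := by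
      simp only [Fintype.sum_option, Option.elim_none, Option.elim_some, mul_ite, mul_one, mul_zero,
        if_true]
      congr!
    simp_rw [this, Finset.prod_univ_sum, Fintype.piFinset_univ, Finset.prod_mul_distrib]
  simp_rw [expand, Finset.mul_sum]
  rw [Finset.sum_comm, Finset.sum_comm (s := (Finset.univ : Finset (I → Bool)))]
  refine Finset.sum_congr rfl fun f _ => ?_
  simp_rw [mul_left_comm _ (∏ j, (f j).elim _ (M j)), ← Finset.mul_sum]
  by_cases hf : ∃ j, f j = none
  · obtain ⟨j, hj⟩ := hf
    obtain ⟨i, hi⟩ : ∃ i, ∀ k, f k ≠ some i := by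
      by_contra! hs
      have hsurj : Function.Surjective f
        | none => ⟨j, hj⟩
        | some i => hs i
      have := Fintype.card_le_of_surjective f hsurj
      rw [Fintype.card_option] at this
      omega
    rw [sum_sign_mul_eq_zero_of_update i, mul_zero, mul_zero]
    intro x b
    refine Finset.prod_congr rfl fun k _ => ?_
    have := hi k
    cases hk : f k with
    | none => rfl
    | some l =>
      have hl : l ≠ i := fun hl => this (hl ▸ hk)
      simp only [Option.elim_some, Function.update_of_ne hl]
      congr!
  · congr 1
    refine Finset.prod_congr rfl fun j _ => ?_
    cases hj : f j with
    | none => exact absurd ⟨j, hj⟩ hf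
    | some i => rfl

/-- The vertex-edge incidence matrix of the octahedron with antipodal pairs `01`, `23`, `45`, every
edge pointing from its smaller to its larger endpoint. -/
def octahedronIncidence : Fin 6 → Fin 12 → ℤ :=
  ![![1, 1, 1, 1, 0, 0, 0, 0, 0, 0, 0, 0],
    ![0, 0, 0, 0, 1, 1, 1, 1, 0, 0, 0, 0],
    ![-1, 0, 0, 0, -1, 0, 0, 0, 1, 1, 0, 0],
    ![0, -1, 0, 0, 0, -1, 0, 0, 0, 0, 1, 1],
    ![0, 0, -1, 0, 0, 0, -1, 0, -1, 0, -1, 0],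
    ![0, 0, 0, -1, 0, 0, 0, -1, 0, -1, 0, -1]]

theorem prod_octahedronIncidence (y : Fin 12 → ℤ) :
    ∏ v, ∑ k, octahedronIncidence v k * y k =
      (y 0 + y 1 + y 2 + y 3) * (y 4 + y 5 + y 6 + y 7) * (y 8 + y 9 - y 0 - y 4) *
        (y 10 + y 11 - y 1 - y 5) * (y 2 + y 6 + y 8 + y 10) * (y 3 + y 7 + y 9 + y 11) := by
  rw [Fin.prod_univ_six]
  have h0 : ∑ k, octahedronIncidence 0 k * y k = y 0 + y 1 + y 2 + y 3 := by
    simp [octahedronIncidence, Fin.sum_univ_succ]; ring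
  have h1 : ∑ k, octahedronIncidence 1 k * y k = y 4 + y 5 + y 6 + y 7 := by
    simp [octahedronIncidence, Fin.sum_univ_succ]; ring
  have h2 : ∑ k, octahedronIncidence 2 k * y k = y 8 + y 9 - y 0 - y 4 := by
    simp [octahedronIncidence, Fin.sum_univ_succ]; ring
  have h3 : ∑ k, octahedronIncidence 3 k * y k = y 10 + y 11 - y 1 - y 5 := by
    simp [octahedronIncidence, Fin.sum_univ_succ]; ring
  have h4 : ∑ k, octahedronIncidence 4 k * y k = -(y 2 + y 6 + y 8 + y 10) := by
    simp [octahedronIncidence, Fin.sum_univ_succ]; ring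
  have h5 : ∑ k, octahedronIncidence 5 k * y k = -(y 3 + y 7 + y 9 + y 11) := by
    simp [octahedronIncidence, Fin.sum_univ_succ]; ring
  rw [h0, h1, h2, h3, h4, h5, mul_neg, mul_neg, neg_mul, neg_neg]

theorem octahedron_iteratedDifference_ne_zero :
    iteratedDifference 12 (fun y => (∏ v, ∑ k, octahedronIncidence v k * y k) ^ 2) ≠ 0 := by
  simp only [prod_octahedronIncidence]
  decide +kernel

/-- The orientation of the octahedron described by `x`, together with the arc `(4, 5)` if `e`
holds. -/
def octahedronOrientation (e : Bool) (x : Fin 12 → Bool) : Fin 6 → Fin 6 → Bool :=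
  ![![false, false, x 0, x 1, x 2, x 3],
    ![false, false, x 4, x 5, x 6, x 7],
    ![!x 0, !x 4, false, false, x 8, x 9],
    ![!x 1, !x 5, false, false, x 10, x 11],
    ![!x 2, !x 6, !x 8, !x 10, false, e],
    ![!x 3, !x 7, !x 9, !x 11, false, false]]

theorem card_octahedronOrientation (e : Bool) (x : Fin 12 → Bool) (v : Fin 6) :
    ((Finset.univ.filter fun w => octahedronOrientation e x v w = true).card : ℤ) =
      ![0, 0, 2, 2, 4 + (if e then 1 else 0), 4] v +
        ∑ k, if x k then octahedronIncidence v k else 0 := by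
  rw [Finset.card_filter, Fin.sum_univ_six]
  simp only [Fin.sum_univ_succ, Fin.sum_univ_zero]
  fin_cases v <;>
    simp [octahedronOrientation, octahedronIncidence] <;>
    grind

theorem exists_octahedronOrientation_avoiding (e : Bool) (a b : Fin 6 → ℤ) :
    ∃ x : Fin 12 → Bool, ∀ v,
      ((Finset.univ.filter fun w => octahedronOrientation e x v w = true).card : ℤ) ≠ a v ∧
      ((Finset.univ.filter fun w => octahedronOrientation e x v w = true).card : ℤ) ≠ b v := by
  set c : Fin 6 → ℤ := ![0, 0, 2, 2, 4 + (if e then 1 else 0), 4] with hc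
  have key := sum_sign_mul_prod_affine_eq (I := Fin 12) (J := Fin 6 ⊕ Fin 6) (by simp)
    (Sum.elim octahedronIncidence octahedronIncidence)
    (Sum.elim (fun v => c v - a v) (fun v => c v - b v)) (fun _ => 0)
  have hne := octahedron_iteratedDifference_ne_zero
  rw [iteratedDifference_eq_sum] at hne
  simp only [Fintype.prod_sum_type, Sum.elim_inl, Sum.elim_inr, zero_add, ← sq] at key
  have hmul (m : ℤ) (t : Bool) : m * t.toInt = if t then m else 0 := by cases t <;> simp
  simp only [hmul] at hne
  rw [← key] at hne
  obtain ⟨x, -, hx⟩ := Finset.exists_ne_zero_of_sum_ne_zero hne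
  refine ⟨x, fun v => ?_⟩
  rw [card_octahedronOrientation, ← hc]
  have h1 := Finset.prod_ne_zero_iff.1 (left_ne_zero_of_mul (right_ne_zero_of_mul hx)) v
    (Finset.mem_univ v)
  have h2 := Finset.prod_ne_zero_iff.1 (right_ne_zero_of_mul (right_ne_zero_of_mul hx)) v
    (Finset.mem_univ v)
  constructor <;> intro h
  · exact h1 (by linarith)
  · exact h2 (by linarith)

theorem octahedronOrientation_not_both (e : Bool) (x : Fin 12 → Bool) (i j : Fin 6) :
    ¬ (octahedronOrientation e x i j = true ∧ octahedronOrientation e x j i = true) := by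
  fin_cases i <;> fin_cases j <;> simp [octahedronOrientation]

theorem octahedronOrientation_adj_iff (e : Bool) (x : Fin 12 → Bool) (i j : Fin 6) :
    (octahedronOrientation e x i j = true ∨ octahedronOrientation e x j i = true) ↔
      i ≠ j ∧ s(i, j) ≠ s(0, 1) ∧ s(i, j) ≠ s(2, 3) ∧ (s(i, j) = s(4, 5) → e = true) := by
  fin_cases i <;> fin_cases j <;> simp [octahedronOrientation]

theorem Finset.exists_subset_pair_of_card_le_two {s : Finset ℕ} (hs : s.card ≤ 2) :
    ∃ a b, s ⊆ {a, b} := by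
  obtain ⟨t, hst, ht⟩ := Infinite.exists_superset_card_eq s 2 hs
  obtain ⟨a, b, -, rfl⟩ := Finset.card_eq_two.1 ht
  exact ⟨a, b, hst⟩

/-- The vertices of `K₆` can be relabelled so that a given matching with at least two edges
consists of `01`, `23` and possibly `45`. -/
theorem exists_perm_matching (m : Finset (Sym2 (Fin 6)))
    (hm1 : ∀ e ∈ m, ¬ e.IsDiag)
    (hm2 : ∀ e₁ ∈ m, ∀ e₂ ∈ m, e₁ ≠ e₂ → ∀ v : Fin 6, v ∈ e₁ → v ∉ e₂)
    (hm3 : 2 ≤ m.card) :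
    ∃ (σ : Equiv.Perm (Fin 6)) (e : Bool), ∀ i j, s(σ i, σ j) ∈ m ↔
      s(i, j) = s(0, 1) ∨ s(i, j) = s(2, 3) ∨ (s(i, j) = s(4, 5) ∧ e = false) := by
  obtain ⟨e₁, h₁, e₂, h₂, hne⟩ := Finset.one_lt_card.1 hm3
  induction e₁ with | _ a b
  induction e₂ with | _ c d
  have hab : a ≠ b := hm1 _ h₁
  have hcd : c ≠ d := hm1 _ h₂
  have ha := hm2 _ h₁ _ h₂ hne a (by simp)
  have hb := hm2 _ h₁ _ h₂ hne b (by simp)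
  simp only [Sym2.mem_iff, not_or] at ha hb
  obtain ⟨p, q, hpq, hs⟩ : ∃ p q, p ≠ q ∧ ({a, b, c, d} : Finset (Fin 6))ᶜ = {p, q} := by
    apply Finset.card_eq_two.1
    have : ({a, b, c, d} : Finset (Fin 6)).card = 4 :=
      Finset.card_eq_four.2 ⟨a, b, c, d, hab, ha.1, ha.2, hb.1, hb.2, hcd, rfl⟩
    rw [Finset.card_compl, this, Fintype.card_fin]
  have hp : p ∈ ({a, b, c, d} : Finset (Fin 6))ᶜ := by simp [hs]
  have hq : q ∈ ({a, b, c, d} : Finset (Fin 6))ᶜ := by simp [hs]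
  simp only [Finset.mem_compl, Finset.mem_insert, Finset.mem_singleton, not_or] at hp hq
  have hinj : Function.Injective ![a, b, c, d, p, q] := by
    intro i j h
    fin_cases i <;> fin_cases j <;> simp at h ⊢ <;> grind
  refine ⟨Equiv.ofBijective _ (Finite.injective_iff_bijective.1 hinj), !decide (s(p, q) ∈ m), ?_⟩
  have hmap (i j k l : Fin 6) : s(![a, b, c, d, p, q] i, ![a, b, c, d, p, q] j) =
      s(![a, b, c, d, p, q] k, ![a, b, c, d, p, q] l) ↔ s(i, j) = s(k, l) := by
    simp [hinj.eq_iff]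
  intro i j
  rw [← hmap, ← hmap i j 2 3, ← hmap i j 4 5]
  simp only [Equiv.ofBijective_apply]
  change _ ↔ _ = s(a, b) ∨ _ = s(c, d) ∨ (_ = s(p, q) ∧ _)
  rw [Bool.not_eq_false', decide_eq_true_iff]
  generalize ![a, b, c, d, p, q] i = u, ![a, b, c, d, p, q] j = v
  refine ⟨fun h => ?_, by rintro (h | h | ⟨h, h'⟩) <;> rwa [h]⟩
  by_cases hu₁ : s(u, v) = s(a, b)
  · exact .inl hu₁
  by_cases hu₂ : s(u, v) = s(c, d)
  · exact .inr (.inl hu₂)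
  have mem_pair (w : Fin 6) (hw : w ∈ s(u, v)) : w = p ∨ w = q := by
    have hw₁ := hm2 _ h _ h₁ hu₁ w hw
    have hw₂ := hm2 _ h _ h₂ hu₂ w hw
    have : w ∈ ({a, b, c, d} : Finset (Fin 6))ᶜ := by
      simp only [Sym2.mem_iff] at hw₁ hw₂
      simp only [Finset.mem_compl, Finset.mem_insert, Finset.mem_singleton]
      tauto
    simpa [hs] using this
  have huv : u ≠ v := hm1 _ h
  have heq : s(u, v) = s(p, q) := by
    rw [Sym2.eq_iff]
    have := mem_pair u (by simp)
    have := mem_pair v (by simp)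
    grind
  exact .inr (.inr ⟨heq, heq ▸ h⟩)

/-- `K₆` minus a matching of size at least 2 admits an `F`-avoiding
orientation whenever `|F(v)| ≤ 2` for all `v`. -/
theorem stmt8 (m : Finset (Sym2 (Fin 6)))
    (hm1 : ∀ e ∈ m, ¬ e.IsDiag)
    (hm2 : ∀ e₁ ∈ m, ∀ e₂ ∈ m, e₁ ≠ e₂ → ∀ v : Fin 6, v ∈ e₁ → v ∉ e₂)
    (hm3 : 2 ≤ m.card)
    (F : Fin 6 → Finset ℕ) (hF : ∀ v, (F v).card ≤ 2) :
    ∃ D : Fin 6 → Fin 6 → Bool,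
      (∀ u v, ((⊤ : SimpleGraph (Fin 6)).deleteEdges ↑m).Adj u v ↔
        (D u v = true ∨ D v u = true)) ∧
      (∀ u v, ¬ (D u v = true ∧ D v u = true)) ∧
      (∀ v, (Finset.univ.filter fun w => D v w = true).card ∉ F v) := by
  obtain ⟨σ, e, hσ⟩ := exists_perm_matching m hm1 hm2 hm3
  choose a b hab using fun v => Finset.exists_subset_pair_of_card_le_two (hF v)
  obtain ⟨x, hx⟩ := exists_octahedronOrientation_avoiding e (fun v => a (σ v)) (fun v => b (σ v))
  refine ⟨fun u v => octahedronOrientation e x (σ.symm u) (σ.symm v), fun u v => ?_,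
    fun u v => octahedronOrientation_not_both e x _ _, fun v hv => ?_⟩
  · obtain ⟨i, rfl⟩ := σ.surjective u
    obtain ⟨j, rfl⟩ := σ.surjective v
    simp only [SimpleGraph.deleteEdges_adj, SimpleGraph.top_adj, Finset.mem_coe, hσ,
      Equiv.symm_apply_apply, octahedronOrientation_adj_iff, σ.injective.ne_iff]
    cases e <;> simp
  · obtain ⟨i, rfl⟩ := σ.surjective v
    have hcard : (Finset.univ.filter fun w =>
        octahedronOrientation e x (σ.symm (σ i)) (σ.symm w) = true).card =
        (Finset.univ.filter fun w => octahedronOrientation e x i w = true).card := by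
      refine Finset.card_equiv σ.symm fun w => ?_
      simp
    rw [hcard] at hv
    have := hab _ hv
    simp only [Finset.mem_insert, Finset.mem_singleton] at this
    have := hx i
    omega
end

section
/- Let G be a graph and F : V(G) → 2^ℕ such that for each vertex v: every maximal interval of forbidden values (hole) in {0,…,d(v)} has size at most 2; between any two distinct holes lies an allowed interval (home) of size at least 3; and the intervals containing 0 and d(v) are homes of size at least 2. Then G admits an F-avoiding orientation. -/
attribute [local instance] Classical.propDecidable

namespace Multigraph

variable {V E : Type} {G : Multigraph V E}

namespace Orientation

theorem tail_ne_head (D : G.Orientation) (e : E) : D.tail e ≠ D.head e := by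
  intro h
  apply G.loopless e
  rw [D.consistent e, h]
  exact Sym2.mk_isDiag_iff.2 rfl

/-- Reverse a single edge. -/
noncomputable def flip (D : G.Orientation) (e : E) : G.Orientation where
  tail := Function.update D.tail e (D.head e)
  head := Function.update D.head e (D.tail e)
  consistent e' := by
    by_cases h : e' = e
    · subst h
      simp [D.consistent, Sym2.eq_swap]
    · simp [h, D.consistent]

/-- Reverse every edge. -/
def reverse (D : G.Orientation) : G.Orientation where
  tail := D.head
  head := D.tail
  consistent e := by rw [D.consistent, Sym2.eq_swap]

theorem flip_tail_self (D : G.Orientation) (e : E) : (D.flip e).tail e = D.head e := by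
  simp [flip]

theorem flip_head_self (D : G.Orientation) (e : E) : (D.flip e).head e = D.tail e := by
  simp [flip]

theorem flip_tail_of_ne (D : G.Orientation) {e f : E} (h : f ≠ e) :
    (D.flip e).tail f = D.tail f := by
  simp [flip, h]

theorem flip_head_of_ne (D : G.Orientation) {e f : E} (h : f ≠ e) :
    (D.flip e).head f = D.head f := by
  simp [flip, h]

variable [Fintype E]

theorem outDeg_eq_sum (D : G.Orientation) (v : V) :
    (D.outDeg v : ℤ) = ∑ e, if D.tail e = v then 1 else 0 := by
  simp [outDeg]

theorem outDeg_flip (D : G.Orientation) (e : E) (v : V) :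
    ((D.flip e).outDeg v : ℤ) =
      D.outDeg v - (if D.tail e = v then 1 else 0) + (if D.head e = v then 1 else 0) := by
  rw [outDeg_eq_sum, outDeg_eq_sum, ← Finset.add_sum_erase _ _ (Finset.mem_univ e),
    ← Finset.add_sum_erase (a := e) _ (fun e => if D.tail e = v then (1 : ℤ) else 0)
      (Finset.mem_univ e), flip_tail_self]
  have : ∑ f ∈ Finset.univ.erase e, (if (D.flip e).tail f = v then (1 : ℤ) else 0) =
      ∑ f ∈ Finset.univ.erase e, if D.tail f = v then (1 : ℤ) else 0 := by
    refine Finset.sum_congr rfl fun f hf => ?_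
    rw [flip_tail_of_ne D (Finset.ne_of_mem_erase hf)]
  rw [this]
  ring

theorem outDeg_flip_tail (D : G.Orientation) (e : E) :
    ((D.flip e).outDeg (D.tail e) : ℤ) = D.outDeg (D.tail e) - 1 := by
  simp [outDeg_flip, (D.tail_ne_head e).symm]

theorem outDeg_flip_head (D : G.Orientation) (e : E) :
    ((D.flip e).outDeg (D.head e) : ℤ) = D.outDeg (D.head e) + 1 := by
  simp [outDeg_flip, D.tail_ne_head e]

theorem outDeg_flip_of_ne (D : G.Orientation) (e : E) {v : V} (ht : v ≠ D.tail e)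
    (hh : v ≠ D.head e) : ((D.flip e).outDeg v : ℤ) = D.outDeg v := by
  simp [outDeg_flip, ht.symm, hh.symm]

theorem outDeg_add_outDeg_reverse (D : G.Orientation) (v : V) :
    (D.outDeg v : ℤ) + D.reverse.outDeg v = G.deg v := by
  have hdeg : (G.deg v : ℤ) = ∑ e, if v ∈ G.ends e then 1 else 0 := by simp [deg]
  rw [outDeg_eq_sum, outDeg_eq_sum, hdeg, ← Finset.sum_add_distrib]
  refine Finset.sum_congr rfl fun e _ => ?_
  have hne := D.tail_ne_head e
  simp only [D.consistent e, Sym2.mem_iff]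
  change _ + (if D.head e = v then (1 : ℤ) else 0) = _
  by_cases h1 : D.tail e = v
  · have h2 : D.head e ≠ v := fun h => hne (h1.trans h.symm)
    simp [h1, h2]
  · by_cases h2 : D.head e = v
    · simp [h1, h2]
    · simp [h1, h2, Ne.symm h1, Ne.symm h2]

theorem exists_tail_eq_of_two_le (D : G.Orientation) {v : V} (h : 2 ≤ D.outDeg v) (e : E) :
    ∃ f, f ≠ e ∧ D.tail f = v := by
  obtain ⟨f, hf, hfe⟩ := Finset.exists_mem_ne (show 1 < _ from h) e
  exact ⟨f, hfe, (Finset.mem_filter.1 hf).2⟩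

theorem exists_tail_eq_of_pos (D : G.Orientation) {v : V} (h : 0 < D.outDeg v) :
    ∃ f, D.tail f = v := by
  obtain ⟨f, hf⟩ := Finset.card_pos.1 h
  exact ⟨f, (Finset.mem_filter.1 hf).2⟩

theorem exists_head_eq_of_lt (D : G.Orientation) {v : V} (h : D.outDeg v < G.deg v) :
    ∃ f, D.head f = v := by
  have := D.outDeg_add_outDeg_reverse v
  exact exists_tail_eq_of_pos D.reverse (v := v) (by omega)

end Orientation

/-- The penalty of the value `i`: `3` if it is forbidden, `1` if it is allowed but next to a
forbidden value, and `0` otherwise. -/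
noncomputable def penalty (P : ℤ → Prop) (i : ℤ) : ℕ :=
  if P i then 3 else if P (i - 1) ∨ P (i + 1) then 1 else 0

theorem penalty_of_forbidden {P : ℤ → Prop} {i : ℤ} (h : P i) : penalty P i = 3 := by
  simp [penalty, h]

theorem penalty_le_one {P : ℤ → Prop} {i : ℤ} (h : ¬ P i) : penalty P i ≤ 1 := by
  unfold penalty
  split_ifs <;> simp

theorem penalty_le_three (P : ℤ → Prop) (i : ℤ) : penalty P i ≤ 3 := by
  unfold penalty
  split_ifs <;> simp

theorem penalty_of_lt_forbidden {P : ℤ → Prop} {i : ℤ} (h : ¬ P i) (h' : P (i + 1)) :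
    penalty P i = 1 := by
  simp [penalty, h, h']

theorem penalty_of_forbidden_lt {P : ℤ → Prop} {i : ℤ} (h : ¬ P i) (h' : P (i - 1)) :
    penalty P i = 1 := by
  simp [penalty, h, h']

theorem penalty_of_loose {P : ℤ → Prop} {i : ℤ} (h : ¬ P i) (h₁ : ¬ P (i - 1))
    (h₂ : ¬ P (i + 1)) : penalty P i = 0 := by
  simp [penalty, h, h₁, h₂]

/-- Conditions on the forbidden values at a vertex of degree `d`: holes have size at most `2`,
homes between holes have size at least `3`, and the two end homes have size at least `2`. -/
structure SmallHoles (P : ℤ → Prop) (d : ℤ) : Prop where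
  zero : ¬ P 0
  one : ¬ P 1
  last : ¬ P d
  last_sub_one : ¬ P (d - 1)
  hole : ∀ i, P i → P (i + 1) → ¬ P (i + 2)
  home : ∀ i, P i → ¬ P (i + 1) → ¬ P (i + 2) ∧ ¬ P (i + 3)

theorem SmallHoles.reflect {P : ℤ → Prop} {d : ℤ} (h : SmallHoles P d) :
    SmallHoles (fun i => P (d - i)) d where
  zero := by simpa using h.last
  one := h.last_sub_one
  last := by simpa using h.zero
  last_sub_one := by simpa using h.one
  hole i h₀ h₁ h₂ := by
    refine h.hole _ h₂ ?_ ?_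
    · convert h₁ using 1; ring
    · convert h₀ using 1; ring
  home i h₀ h₁ := by
    have key : ¬ P (d - (i + 2)) := by
      intro h₂
      refine (h.home _ h₂ ?_).1 ?_
      · convert h₁ using 2; ring
      · convert h₀ using 1; ring
    refine ⟨key, fun h₃ => (h.home _ h₃ ?_).2 ?_⟩
    · convert key using 2; ring
    · convert h₀ using 1; ring

theorem SmallHoles.below {P : ℤ → Prop} {d i : ℤ} (h : SmallHoles P d) (hi : ¬ P i)
    (hi' : P (i + 1)) : ¬ P (i - 1) ∧ ¬ P (i - 2) := by
  have key : ¬ P (i - 1) := by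
    intro h₁
    refine (h.home _ h₁ ?_).1 ?_
    · simpa using hi
    · convert hi' using 1; ring
  refine ⟨key, fun h₂ => (h.home _ h₂ ?_).2 ?_⟩
  · convert key using 2; ring
  · convert hi' using 1; ring

namespace Orientation

variable [Fintype E]

/-- The total penalty of an orientation over the vertices in `S`. -/
noncomputable def totalPenalty (P : V → ℤ → Prop) (S : Finset V) (D : G.Orientation) : ℕ :=
  ∑ v ∈ S, penalty (P v) (D.outDeg v)

theorem totalPenalty_flip (P : V → ℤ → Prop) {S : Finset V} (hS : ∀ e, ∀ w ∈ G.ends e, w ∈ S)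
    (D : G.Orientation) (e : E) :
    totalPenalty P S (D.flip e) + penalty (P (D.tail e)) (D.outDeg (D.tail e)) +
        penalty (P (D.head e)) (D.outDeg (D.head e)) =
      totalPenalty P S D + penalty (P (D.tail e)) (D.outDeg (D.tail e) - 1) +
        penalty (P (D.head e)) (D.outDeg (D.head e) + 1) := by
  have ht : D.tail e ∈ S := hS e _ (by rw [D.consistent]; exact Sym2.mem_mk_left _ _)
  have hh : D.head e ∈ S.erase (D.tail e) :=
    Finset.mem_erase.2 ⟨(D.tail_ne_head e).symm,
      hS e _ (by rw [D.consistent]; exact Sym2.mem_mk_right _ _)⟩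
  unfold totalPenalty
  rw [← Finset.add_sum_erase _ _ ht, ← Finset.add_sum_erase _ _ hh,
    ← Finset.add_sum_erase (a := D.tail e) _ (fun v => penalty (P v) (D.outDeg v)) ht,
    ← Finset.add_sum_erase (a := D.head e) _ (fun v => penalty (P v) (D.outDeg v)) hh,
    outDeg_flip_tail, outDeg_flip_head]
  have : ∑ v ∈ (S.erase (D.tail e)).erase (D.head e), penalty (P v) ((D.flip e).outDeg v) =
      ∑ v ∈ (S.erase (D.tail e)).erase (D.head e), penalty (P v) (D.outDeg v) := by
    refine Finset.sum_congr rfl fun v hv => ?_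
    simp only [Finset.mem_erase] at hv
    rw [outDeg_flip_of_ne D e hv.2.1 hv.1]
  rw [this]
  ring

/-- `D` has the least total penalty among all orientations. -/
def IsOptimal (P : V → ℤ → Prop) (S : Finset V) (D : G.Orientation) : Prop :=
  ∀ D' : G.Orientation, totalPenalty P S D ≤ totalPenalty P S D'

variable {P : V → ℤ → Prop} {S : Finset V} {D : G.Orientation}

theorem IsOptimal.flip (hS : ∀ e, ∀ w ∈ G.ends e, w ∈ S) (hD : IsOptimal P S D) {f : E}
    (hbad : P (D.tail f) (D.outDeg (D.tail f)))
    (hlow : ¬ P (D.tail f) (D.outDeg (D.tail f) - 1)) :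
    ¬ P (D.head f) (D.outDeg (D.head f)) ∧ P (D.head f) (D.outDeg (D.head f) + 1) ∧
      IsOptimal P S (D.flip f) := by
  have hflip := totalPenalty_flip P hS D f
  have hmin := hD (D.flip f)
  have h₁ := penalty_of_forbidden hbad
  have h₂ := penalty_of_lt_forbidden hlow (by simpa using hbad)
  have h₃ : ¬ P (D.head f) (D.outDeg (D.head f)) := by
    intro h
    have := penalty_of_forbidden h
    have := penalty_le_three (P (D.head f)) (D.outDeg (D.head f) + 1)
    omega
  have h₄ : P (D.head f) (D.outDeg (D.head f) + 1) := by
    by_contra h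
    have := penalty_le_one h
    omega
  refine ⟨h₃, h₄, fun D' => ?_⟩
  have := penalty_of_forbidden h₄
  have := penalty_of_lt_forbidden h₃ h₄
  have := hD D'
  omega

theorem IsOptimal.not_forbidden_of_tail (hS : ∀ e, ∀ w ∈ G.ends e, w ∈ S)
    (hP : ∀ v, SmallHoles (P v) (G.deg v)) (hD : IsOptimal P S D) {f : E}
    (ha : ¬ P (D.tail f) (D.outDeg (D.tail f)))
    (ha' : P (D.tail f) (D.outDeg (D.tail f) + 1)) :
    ¬ P (D.head f) (D.outDeg (D.head f)) := by
  intro hbad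
  have hflip := totalPenalty_flip P hS D f
  have hmin := hD (D.flip f)
  have h₁ := penalty_of_forbidden hbad
  obtain ⟨hb₁, hb₂⟩ := (hP _).below ha ha'
  have h₂ := penalty_of_lt_forbidden ha ha'
  have h₃ : penalty (P (D.tail f)) (D.outDeg (D.tail f) - 1) = 0 :=
    penalty_of_loose hb₁ (by convert hb₂ using 2; ring) (by simpa using ha)
  have h₄ : P (D.head f) (D.outDeg (D.head f) + 1) := by
    by_contra h
    have := penalty_le_one h
    omega
  have h₅ := penalty_of_forbidden h₄
  have h₆ := (hP _).hole _ hbad h₄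
  have hh := D.outDeg_flip_head f
  have hlt : (D.flip f).outDeg (D.head f) < G.deg (D.head f) := by
    have hle := (D.flip f).outDeg_add_outDeg_reverse (D.head f)
    refine lt_of_le_of_ne (by omega) fun h => (hP (D.head f)).last ?_
    rw [← h, hh]
    exact h₄
  obtain ⟨g, hg⟩ := (D.flip f).exists_head_eq_of_lt hlt
  have hflip' := totalPenalty_flip P hS (D.flip f) g
  have hmin' := hD ((D.flip f).flip g)
  have hgne := (D.flip f).tail_ne_head g
  rw [hg, hh, show (D.outDeg (D.head f) + 1 + 1 : ℤ) = D.outDeg (D.head f) + 2 by ring] at hflip'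
  have h₇ := penalty_le_one h₆
  by_cases hga : (D.flip f).tail g = D.tail f
  · rw [hga, D.outDeg_flip_tail,
      show (D.outDeg (D.tail f) - 1 - 1 : ℤ) = D.outDeg (D.tail f) - 2 by ring] at hflip'
    have := penalty_le_one hb₂
    omega
  · have hgx := D.outDeg_flip_of_ne f hga (hg ▸ hgne)
    rw [hgx] at hflip'
    by_cases h₈ : P ((D.flip f).tail g) (D.outDeg ((D.flip f).tail g))
    · have := penalty_of_forbidden h₈
      have := penalty_le_three (P ((D.flip f).tail g)) (D.outDeg ((D.flip f).tail g) - 1)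
      omega
    · by_cases h₉ : P ((D.flip f).tail g) (D.outDeg ((D.flip f).tail g) - 1)
      · have := penalty_of_forbidden h₉
        have := penalty_of_forbidden_lt h₈ h₉
        omega
      · have := penalty_le_one h₉
        omega

/-- The state of a non-backtracking walk which started at a vertex with forbidden out-degree and
reversed each edge it traversed: `c` is the current vertex, `e` the edge used last, and `W` the
set of the vertices left behind. -/
structure WalkState (P : V → ℤ → Prop) (S : Finset V) (D : G.Orientation) (W : Finset V) (c : V)
    (e : E) : Prop where
  optimal : IsOptimal P S D
  notMem : c ∉ W
  forbidden : P c (D.outDeg c)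
  below : ¬ P c (D.outDeg c - 1)
  visited : ∀ u ∈ W, ¬ P u (D.outDeg u) ∧ P u (D.outDeg u + 1)
  entered : ∀ u ∈ W, ∃ f, D.head f = u ∧ (f = e ∧ D.tail f = c ∨ D.tail f ∈ W)

theorem WalkState.card_le {W : Finset V} {c : V} {e : E} (h : WalkState P S D W c e) :
    W.card ≤ Fintype.card E := by
  have : W ⊆ Finset.univ.image D.head := by
    intro u hu
    obtain ⟨f, hf, -⟩ := h.entered u hu
    exact Finset.mem_image.2 ⟨f, Finset.mem_univ _, hf⟩
  exact (Finset.card_le_card this).trans Finset.card_image_le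

theorem WalkState.step (hS : ∀ e, ∀ w ∈ G.ends e, w ∈ S)
    (hP : ∀ v, SmallHoles (P v) (G.deg v)) {W : Finset V} {c : V} {e : E}
    (h : WalkState P S D W c e) :
    ∃ (D' : G.Orientation) (c' : V) (e' : E), WalkState P S D' (insert c W) c' e' := by
  have h2 : 2 ≤ D.outDeg c := by
    by_contra hlt
    have : D.outDeg c = 0 ∨ D.outDeg c = 1 := by omega
    have hf := h.forbidden
    rcases this with h0 | h0 <;> rw [h0] at hf
    · exact (hP c).zero (by simpa using hf)
    · exact (hP c).one (by simpa using hf)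
  obtain ⟨f, hfe, hfc⟩ := D.exists_tail_eq_of_two_le h2 e
  have hne := D.tail_ne_head f
  obtain ⟨hy, hy', hopt⟩ := h.optimal.flip hS (hfc ▸ h.forbidden) (hfc ▸ h.below)
  have hxc : ((D.flip f).outDeg c : ℤ) = D.outDeg c - 1 := hfc ▸ D.outDeg_flip_tail f
  have hxy := D.outDeg_flip_head f
  have hc : ¬ P c ((D.flip f).outDeg c) ∧ P c ((D.flip f).outDeg c + 1) := by
    rw [hxc]
    exact ⟨h.below, by simpa using h.forbidden⟩
  have hvis : ∀ u ∈ W, u ≠ D.head f →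
      ¬ P u ((D.flip f).outDeg u) ∧ P u ((D.flip f).outDeg u + 1) := by
    intro u hu huy
    have huc : u ≠ D.tail f := fun h' => h.notMem (by rwa [← hfc, ← h'])
    rw [D.outDeg_flip_of_ne f huc huy]
    exact h.visited u hu
  have hbad : P (D.head f) ((D.flip f).outDeg (D.head f)) := by rwa [hxy]
  have hent : ∀ u ∈ W, ∃ g, g ≠ f ∧ D.head g = u ∧ D.tail g ∈ insert c W := by
    intro u hu
    obtain ⟨g, hg, hg'⟩ := h.entered u hu
    rcases hg' with ⟨rfl, hg'⟩ | hg'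
    · exact ⟨g, hfe.symm, hg, by simp [hg']⟩
    · refine ⟨g, ?_, hg, by simp [hg']⟩
      rintro rfl
      exact h.notMem (hfc ▸ hg')
  by_cases hW : D.head f ∈ W
  · exfalso
    obtain ⟨g, hgf, hg, hgW⟩ := hent _ hW
    have ht := D.flip_tail_of_ne hgf
    have hh := (D.flip_head_of_ne hgf).trans hg
    have htop : ¬ P (D.tail g) ((D.flip f).outDeg (D.tail g)) ∧
        P (D.tail g) ((D.flip f).outDeg (D.tail g) + 1) := by
      rcases Finset.mem_insert.1 hgW with hgc | hgW
      · rw [hgc]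
        exact hc
      · exact hvis _ hgW (hg ▸ D.tail_ne_head g)
    rw [← ht] at htop
    refine hopt.not_forbidden_of_tail hS hP htop.1 htop.2 ?_
    rwa [hh]
  · refine ⟨D.flip f, D.head f, f, hopt, ?_, hbad, ?_, ?_, ?_⟩
    · simp only [Finset.mem_insert, not_or]
      exact ⟨hfc ▸ hne.symm, hW⟩
    · rw [hxy]
      simpa using hy
    · intro u hu
      rcases Finset.mem_insert.1 hu with rfl | hu
      · exact hc
      · exact hvis u hu fun h' => hW (h' ▸ hu)
    · intro u hu
      rcases Finset.mem_insert.1 hu with rfl | hu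
      · exact ⟨f, (D.flip_head_self f).trans hfc, Or.inl ⟨rfl, D.flip_tail_self f⟩⟩
      · obtain ⟨g, hgf, hg, hgW⟩ := hent u hu
        exact ⟨g, (D.flip_head_of_ne hgf).trans hg, Or.inr (by rwa [D.flip_tail_of_ne hgf])⟩

theorem IsOptimal.forbidden_sub_one (hS : ∀ e, ∀ w ∈ G.ends e, w ∈ S)
    (hP : ∀ v, SmallHoles (P v) (G.deg v)) (hD : IsOptimal P S D) {v : V}
    (hv : P v (D.outDeg v)) : P v (D.outDeg v - 1) := by
  by_contra hv'
  have hpos : 0 < D.outDeg v := by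
    refine Nat.pos_of_ne_zero fun h => (hP v).zero ?_
    simpa [h] using hv
  obtain ⟨e, -⟩ := D.exists_tail_eq_of_pos hpos
  have key : ∀ n : ℕ, ∃ (D' : G.Orientation) (W : Finset V) (c : V) (e : E),
      W.card = n ∧ WalkState P S D' W c e := by
    intro n
    induction n with
    | zero => exact ⟨D, ∅, v, e, rfl, hD, by simp, hv, hv', by simp, by simp⟩
    | succ n ih =>
      obtain ⟨D', W, c, e, hn, h⟩ := ih
      obtain ⟨D'', c', e', h'⟩ := h.step hS hP
      exact ⟨D'', insert c W, c', e', by rw [Finset.card_insert_of_notMem h.notMem, hn], h'⟩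
  obtain ⟨D', W, c, e, hn, h⟩ := key (Fintype.card E + 1)
  have := h.card_le
  omega

theorem totalPenalty_reflect_reverse (P : V → ℤ → Prop) (S : Finset V) (D : G.Orientation) :
    totalPenalty (fun v i => P v (G.deg v - i)) S D.reverse = totalPenalty P S D := by
  refine Finset.sum_congr rfl fun v _ => ?_
  have h := D.outDeg_add_outDeg_reverse v
  simp only [penalty, show (G.deg v - D.reverse.outDeg v : ℤ) = D.outDeg v by omega,
    show (G.deg v - (D.reverse.outDeg v - 1) : ℤ) = D.outDeg v + 1 by omega,
    show (G.deg v - (D.reverse.outDeg v + 1) : ℤ) = D.outDeg v - 1 by omega, or_comm]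

theorem IsOptimal.not_forbidden (hS : ∀ e, ∀ w ∈ G.ends e, w ∈ S)
    (hP : ∀ v, SmallHoles (P v) (G.deg v)) (hD : IsOptimal P S D) (v : V) :
    ¬ P v (D.outDeg v) := by
  intro hv
  have hlow := hD.forbidden_sub_one hS hP hv
  have hrev : IsOptimal (fun v i => P v (G.deg v - i)) S D.reverse := by
    intro D'
    rw [totalPenalty_reflect_reverse]
    exact (hD D'.reverse).trans_eq (totalPenalty_reflect_reverse P S D'.reverse).symm
  have h := D.outDeg_add_outDeg_reverse v
  have hup := hrev.forbidden_sub_one hS (fun v => (hP v).reflect) (v := v)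
    (by rwa [show (G.deg v - D.reverse.outDeg v : ℤ) = D.outDeg v by omega])
  rw [show (G.deg v - (D.reverse.outDeg v - 1) : ℤ) = D.outDeg v + 1 by omega] at hup
  refine (hP v).hole _ hlow (by simpa using hv) ?_
  convert hup using 1
  ring

theorem exists_isOptimal (G : Multigraph V E) (P : V → ℤ → Prop) (S : Finset V) :
    ∃ D : G.Orientation, IsOptimal P S D := by
  have hne : Nonempty G.Orientation :=
    ⟨⟨fun e => (G.ends e).out.1, fun e => (G.ends e).out.2, fun e => (Quot.out_eq _).symm⟩⟩
  exact ⟨Function.argmin (totalPenalty P S), fun D' => Function.argmin_le (totalPenalty P S) D'⟩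

end Orientation

end Multigraph

/-- if for each vertex all holes have size at most 2, between any two
distinct holes lies a home of size at least 3, and both end-intervals are homes of
size at least 2 (stated pointwise), then `G` admits an `F`-avoiding orientation. -/
theorem stmt16 {V E : Type} [Fintype E] (G : Multigraph V E) (F : V → Finset ℕ)
    (hsub : ∀ v, ∀ i ∈ F v, i ≤ G.deg v)
    (hend0 : ∀ v, 0 ∉ F v ∧ 1 ∉ F v)
    (hendd : ∀ v, G.deg v ∉ F v ∧ G.deg v - 1 ∉ F v)
    (hhole : ∀ v, ∀ i, ¬ (i ∈ F v ∧ i + 1 ∈ F v ∧ i + 2 ∈ F v))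
    (hhome : ∀ v, ∀ i, i ∈ F v → i + 1 ∉ F v → i + 2 ∉ F v ∧ i + 3 ∉ F v) :
    ∃ D : G.Orientation, D.Avoids F := by
  have hP : ∀ v, Multigraph.SmallHoles (fun i : ℤ => 0 ≤ i ∧ i.toNat ∈ F v) (G.deg v) := by
    intro v
    refine ⟨by simpa using (hend0 v).1, by simpa using (hend0 v).2, by simpa using (hendd v).1,
      ?_, ?_, ?_⟩
    · rintro ⟨-, h⟩
      exact (hendd v).2 (by convert h using 1; omega)
    · rintro i ⟨hi, h₀⟩ ⟨-, h₁⟩ ⟨-, h₂⟩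
      refine hhole v i.toNat ⟨h₀, ?_, ?_⟩
      · convert h₁ using 1; omega
      · convert h₂ using 1; omega
    · rintro i ⟨hi, h₀⟩ h₁
      have := hhome v i.toNat h₀ fun h => h₁ ⟨by omega, by convert h using 1; omega⟩
      refine ⟨fun h => this.1 ?_, fun h => this.2 ?_⟩
      · convert h.2 using 1; omega
      · convert h.2 using 1; omega
  let S : Finset V := Finset.univ.biUnion fun e => (G.ends e).toFinset
  have hS : ∀ e, ∀ w ∈ G.ends e, w ∈ S := fun e w hw =>
    Finset.mem_biUnion.2 ⟨e, Finset.mem_univ _, Sym2.mem_toFinset.2 hw⟩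
  obtain ⟨D, hD⟩ := Multigraph.Orientation.exists_isOptimal G
    (fun v (i : ℤ) => 0 ≤ i ∧ i.toNat ∈ F v) S
  exact ⟨D, fun v hv => hD.not_forbidden hS hP v ⟨by omega, by simpa using hv⟩⟩
end

section
/- Every 6-regular graph G and every set F ⊆ {0,1,…,6} with |F| ≤ 2 admits an F-avoiding orientation. -/
attribute [local instance] Classical.propDecidable

open Finset

namespace Multigraph

section Ends

variable {V E : Type} [Fintype E]

/-- The edges having both ends in `X`, where `e` joins `a e` to `b e`. -/
noncomputable def innerEdges (a b : E → V) (X : Finset V) : Finset E :=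
  univ.filter fun e => a e ∈ X ∧ b e ∈ X

/-- The edges joining `v` to a vertex of `X`, where `e` joins `a e` to `b e`. -/
noncomputable def linkEdges (a b : E → V) (v : V) (X : Finset V) : Finset E :=
  univ.filter fun e => (a e = v ∧ b e ∈ X) ∨ (b e = v ∧ a e ∈ X)

/-- A choice of one end for every edge. -/
def IsTail (a b t : E → V) : Prop := ∀ e, t e = a e ∨ t e = b e

/-- The number of edges whose chosen end is `v`. -/
noncomputable def tailCount (t : E → V) (v : V) : ℕ := (univ.filter fun e => t e = v).card

variable {a b : E → V}

lemma sum_card_filter_eq (P : E → Prop) [DecidablePred P] (f : E → V) (X : Finset V) :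
    ∑ v ∈ X, (univ.filter fun e => f e = v ∧ P e).card =
      (univ.filter fun e => f e ∈ X ∧ P e).card := by
  rw [card_eq_sum_card_fiberwise (f := f) (t := X) (by intro e he; simp at he; exact he.1)]
  refine sum_congr rfl fun v hv => ?_
  congr 1
  ext e
  simp only [mem_filter, mem_univ, true_and]
  grind

lemma card_linkEdges (hab : ∀ e, a e ≠ b e) (v : V) (Y : Finset V) :
    (linkEdges a b v Y).card = (univ.filter fun e => a e = v ∧ b e ∈ Y).card +
      (univ.filter fun e => b e = v ∧ a e ∈ Y).card := by
  rw [linkEdges, filter_or, card_union_of_disjoint]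
  rw [disjoint_left]
  intro e
  simp only [mem_filter, mem_univ, true_and]
  rintro ⟨h, -⟩ ⟨h', -⟩
  exact hab e (h.trans h'.symm)

lemma sum_card_linkEdges (hab : ∀ e, a e ≠ b e) (X Y : Finset V) :
    ∑ v ∈ X, (linkEdges a b v Y).card = (univ.filter fun e => a e ∈ X ∧ b e ∈ Y).card +
      (univ.filter fun e => b e ∈ X ∧ a e ∈ Y).card := by
  simp only [card_linkEdges hab, sum_add_distrib, sum_card_filter_eq]

lemma two_mul_card_innerEdges (hab : ∀ e, a e ≠ b e) (X : Finset V) :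
    2 * (innerEdges a b X).card = ∑ v ∈ X, (linkEdges a b v X).card := by
  rw [sum_card_linkEdges hab, two_mul, innerEdges]
  simp only [and_comm]

lemma linkEdges_mono (v : V) {X Y : Finset V} (h : X ⊆ Y) :
    linkEdges a b v X ⊆ linkEdges a b v Y := by
  intro e
  simp only [linkEdges, mem_filter, mem_univ, true_and]
  grind

lemma card_innerEdges_insert {v : V} {X : Finset V} (hab : ∀ e, a e ≠ b e) (hv : v ∉ X) :
    (innerEdges a b (insert v X)).card =
      (innerEdges a b X).card + (linkEdges a b v X).card := by
  rw [← card_union_of_disjoint]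
  · congr 1
    ext e
    have := hab e
    simp only [innerEdges, linkEdges, mem_union, mem_filter, mem_univ, true_and, mem_insert]
    grind
  · rw [disjoint_left]
    intro e
    simp only [innerEdges, linkEdges, mem_filter, mem_univ, true_and]
    grind

lemma two_mul_card_innerEdges_le (hab : ∀ e, a e ≠ b e) {T X : Finset V} {k : ℕ}
    (hT : ∀ v ∈ T, (linkEdges a b v T).card ≤ k) (hX : X ⊆ T) :
    2 * (innerEdges a b X).card ≤ k * X.card := by
  rw [two_mul_card_innerEdges hab, mul_comm, ← smul_eq_mul]
  exact sum_le_card_nsmul _ _ _ fun v hv =>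
    (card_le_card (linkEdges_mono v hX)).trans (hT v (hX hv))

lemma sum_ite_mem_eq (X T : Finset V) (m n : ℕ) :
    ∑ v ∈ X, (if v ∈ T then m else n) = m * (X ∩ T).card + n * (X \ T).card := by
  rw [sum_ite, filter_mem_eq_inter, filter_notMem_eq_sdiff]
  simp [mul_comm]

section Fintype

variable [Fintype V]

lemma card_linkEdges_add_compl (hab : ∀ e, a e ≠ b e) (v : V) (X : Finset V) :
    (linkEdges a b v X).card + (linkEdges a b v Xᶜ).card = (linkEdges a b v univ).card := by
  rw [← card_union_of_disjoint]
  · congr 1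
    ext e
    simp only [linkEdges, mem_union, mem_filter, mem_univ, true_and, mem_compl]
    grind
  · rw [disjoint_left]
    intro e
    have := hab e
    simp only [linkEdges, mem_filter, mem_univ, true_and, mem_compl]
    grind

lemma card_touching_add_card_innerEdges (hab : ∀ e, a e ≠ b e) {k : ℕ}
    (hreg : ∀ v, (linkEdges a b v univ).card = k) (X : Finset V) :
    (univ.filter fun e => a e ∈ X ∨ b e ∈ X).card + (innerEdges a b X).card = k * X.card := by
  have h := sum_card_linkEdges hab X univ
  simp only [hreg, sum_const, smul_eq_mul, mem_univ, and_true] at h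
  rw [mul_comm, h, filter_or, innerEdges, filter_and, card_union_add_card_inter]

lemma card_innerEdges_le_inter_add (hab : ∀ e, a e ≠ b e) {k : ℕ}
    (hreg : ∀ v, (linkEdges a b v univ).card = k) (X T : Finset V) :
    (innerEdges a b X).card ≤ (innerEdges a b (X ∩ T)).card + k * (X \ T).card := by
  have h := card_touching_add_card_innerEdges hab hreg (X \ T)
  have hsub : innerEdges a b X ⊆ innerEdges a b (X ∩ T) ∪
      univ.filter fun e => a e ∈ X \ T ∨ b e ∈ X \ T := by
    intro e
    simp only [innerEdges, mem_union, mem_filter, mem_univ, true_and, mem_inter, mem_sdiff]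
    grind
  have := (card_le_card hsub).trans (card_union_le _ _)
  omega

/-- Hakimi's theorem with both lower and upper bounds on out-degrees. -/
theorem exists_isTail_bounds (lo hi : V → ℕ) (hle : ∀ v, lo v ≤ hi v)
    (hup : ∀ X : Finset V, (innerEdges a b X).card ≤ ∑ v ∈ X, hi v)
    (hlow : ∀ X : Finset V,
      ∑ v ∈ X, lo v ≤ (univ.filter fun e => a e ∈ X ∨ b e ∈ X).card) :
    ∃ t, IsTail a b t ∧ ∀ v, lo v ≤ tailCount t v ∧ tailCount t v ≤ hi v := by
  have hE : Fintype.card E ≤ ∑ v, hi v := by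
    simpa [innerEdges, card_univ] using hup univ
  -- Unused slots are filled by dummy edges, which may only use the optional slots.
  let N : E ⊕ Fin (∑ v, hi v - Fintype.card E) → Finset (Σ v : V, Fin (hi v)) :=
    Sum.elim (fun e => univ.filter fun s => s.1 = a e ∨ s.1 = b e)
      (fun _ => univ.filter fun s => lo s.1 ≤ s.2)
  have slots (Y : Finset V) :
      (univ.filter fun s : Σ v : V, Fin (hi v) => s.1 ∈ Y).card = ∑ v ∈ Y, hi v := by
    have : (univ.filter fun s : Σ v : V, Fin (hi v) => s.1 ∈ Y) = Y.sigma fun _ => univ := by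
      ext s; simp
    rw [this, card_sigma]; simp
  have mandatory (Y : Finset V) :
      (univ.filter fun s : Σ v : V, Fin (hi v) => s.1 ∈ Y ∧ ¬ lo s.1 ≤ s.2).card =
        ∑ v ∈ Y, lo v := by
    have : (univ.filter fun s : Σ v : V, Fin (hi v) => s.1 ∈ Y ∧ ¬ lo s.1 ≤ s.2) =
        Y.sigma fun v => univ.filter fun i : Fin (hi v) => (i : ℕ) < lo v := by
      ext s; simp
    rw [this, card_sigma]
    refine sum_congr rfl fun v _ => ?_
    have := hle v
    rw [Fin.card_filter_val_lt]
    omega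
  have hall : ∀ s : Finset (E ⊕ Fin (∑ v, hi v - Fintype.card E)), s.card ≤ (s.biUnion N).card := by
    intro s
    let Y : Finset V := s.toLeft.image a ∪ s.toLeft.image b
    have hY : s.toLeft ⊆ innerEdges a b Y := by
      intro e he
      simp only [innerEdges, mem_filter, mem_univ, true_and, Y, mem_union]
      exact ⟨Or.inl (mem_image_of_mem a he), Or.inr (mem_image_of_mem b he)⟩
    have hYN : (univ.filter fun s : Σ v : V, Fin (hi v) => s.1 ∈ Y) ⊆ s.biUnion N := by
      rintro ⟨v, i⟩ h
      simp only [mem_filter, mem_univ, true_and, Y, mem_union, mem_image, mem_toLeft] at h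
      rw [mem_biUnion]
      rcases h with ⟨e, he, rfl⟩ | ⟨e, he, rfl⟩
      · exact ⟨_, he, by simp [N]⟩
      · exact ⟨_, he, by simp [N]⟩
    have hs := card_toLeft_add_card_toRight (u := s)
    rcases s.toRight.eq_empty_or_nonempty with h0 | ⟨j, hj⟩
    · rw [h0, card_empty] at hs
      have h1 := (card_le_card hY).trans (hup Y)
      have h2 := card_le_card hYN
      rw [slots] at h2
      omega
    · have hr : s.toRight.card ≤ ∑ v, hi v - Fintype.card E := by
        simpa using card_le_univ s.toRight
      have hcompl : (s.biUnion N)ᶜ ⊆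
          univ.filter fun s : Σ v : V, Fin (hi v) => s.1 ∈ Yᶜ ∧ ¬ lo s.1 ≤ s.2 := by
        intro x hx
        rw [mem_compl] at hx
        simp only [mem_filter, mem_univ, true_and, mem_compl]
        refine ⟨fun h => hx (hYN (by simpa using h)), fun h => hx ?_⟩
        rw [mem_biUnion]
        exact ⟨_, mem_toRight.1 hj, by simpa [N] using h⟩
      have h1 := card_le_card hcompl
      rw [mandatory, card_compl] at h1
      have h2 := hlow Yᶜ
      have hdisj : Disjoint s.toLeft (univ.filter fun e => a e ∈ Yᶜ ∨ b e ∈ Yᶜ) := by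
        rw [disjoint_left]
        intro e he
        have := hY he
        simp only [innerEdges, mem_filter, mem_univ, true_and] at this
        simp [this]
      have h3 := card_le_univ (s.toLeft ∪ univ.filter fun e => a e ∈ Yᶜ ∨ b e ∈ Yᶜ)
      rw [card_union_of_disjoint hdisj] at h3
      have h4 : Fintype.card (Σ v : V, Fin (hi v)) = ∑ v, hi v := by simp
      have h5 := card_le_univ (s.biUnion N)
      omega
  obtain ⟨f, hf, hfN⟩ := (all_card_le_biUnion_card_iff_exists_injective N).1 hall
  have hbij : Function.Bijective f := by
    rw [Fintype.bijective_iff_injective_and_card]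
    refine ⟨hf, ?_⟩
    simp only [Fintype.card_sum, Fintype.card_fin, Fintype.card_sigma]
    omega
  refine ⟨fun e => (f (Sum.inl e)).1, fun e => ?_, fun v => ⟨?_, ?_⟩⟩
  · simpa [N] using hfN (Sum.inl e)
  · have hm := mandatory {v}
    rw [sum_singleton] at hm
    rw [← hm, tailCount, ← card_image_of_injective (s := univ.filter fun e =>
      (f (Sum.inl e)).1 = v) (hf.comp Sum.inl_injective)]
    refine card_le_card fun s h => ?_
    simp only [mem_filter, mem_univ, true_and, mem_singleton] at h
    obtain ⟨x, rfl⟩ := hbij.2 s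
    rcases x with e | j
    · exact mem_image.2 ⟨e, by simpa using h.1, rfl⟩
    · have := hfN (Sum.inr j)
      simp only [N, Sum.elim_inr, mem_filter, mem_univ, true_and] at this
      exact absurd this h.2
  · have hm := slots {v}
    rw [sum_singleton] at hm
    rw [← hm, tailCount, ← card_image_of_injective (s := univ.filter fun e =>
      (f (Sum.inl e)).1 = v) (hf.comp Sum.inl_injective)]
    refine card_le_card fun s h => ?_
    obtain ⟨e, he, rfl⟩ := mem_image.1 h
    simpa using he

/-- An instance of Lovász's degree-bounded partition theorem. -/
lemma exists_partition (hab : ∀ e, a e ≠ b e) (hreg : ∀ v, (linkEdges a b v univ).card = 6) :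
    ∃ T : Finset V, (∀ v ∈ T, (linkEdges a b v T).card ≤ 2) ∧
      ∀ v ∈ Tᶜ, (linkEdges a b v Tᶜ).card ≤ 3 := by
  obtain ⟨T, -, hT⟩ := exists_min_image (univ : Finset (Finset V))
    (fun T => (innerEdges a b T).card + (innerEdges a b Tᶜ).card + T.card) univ_nonempty
  refine ⟨T, fun v hv => ?_, fun v hv => ?_⟩
  · have h := hT (T.erase v) (mem_univ _)
    have h1 := card_innerEdges_insert hab (notMem_erase v T)
    have h2 := card_innerEdges_insert (v := v) (X := Tᶜ) hab (by simpa using hv)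
    have h3 := card_linkEdges_add_compl hab v T
    have h4 : linkEdges a b v (T.erase v) = linkEdges a b v T := by
      ext e
      have := hab e
      simp only [linkEdges, mem_filter, mem_univ, true_and, mem_erase]
      grind
    have h5 := card_erase_add_one hv
    rw [compl_erase] at h
    rw [insert_erase hv, h4] at h1
    rw [hreg] at h3
    omega
  · have hv' : v ∉ T := by simpa using hv
    have h := hT (insert v T) (mem_univ _)
    have h1 := card_innerEdges_insert hab hv'
    have h2 := card_innerEdges_insert hab (notMem_erase v Tᶜ)
    have h3 := card_linkEdges_add_compl hab v T
    have h4 : linkEdges a b v (Tᶜ.erase v) = linkEdges a b v Tᶜ := by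
      ext e
      have := hab e
      simp only [linkEdges, mem_filter, mem_univ, true_and, mem_erase]
      grind
    rw [compl_insert, card_insert_of_notMem hv'] at h
    rw [insert_erase hv, h4] at h2
    rw [hreg] at h3
    omega

lemma card_innerEdges_le_three_mul (hab : ∀ e, a e ≠ b e)
    (hreg : ∀ v, (linkEdges a b v univ).card = 6) (X : Finset V) :
    (innerEdges a b X).card ≤ 3 * X.card := by
  have := two_mul_card_innerEdges_le hab (fun v _ => (hreg v).le) (subset_univ X)
  omega

theorem exists_isTail_eq_three (hab : ∀ e, a e ≠ b e)
    (hreg : ∀ v, (linkEdges a b v univ).card = 6) :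
    ∃ t, IsTail a b t ∧ ∀ v, tailCount t v = 3 := by
  have hin := card_innerEdges_le_three_mul hab hreg
  obtain ⟨t, ht, h⟩ := exists_isTail_bounds (a := a) (b := b) (fun _ => 3) (fun _ => 3)
    (fun _ => le_rfl) (fun X => by simpa [mul_comm] using hin X) (fun X => by
      have h1 := card_touching_add_card_innerEdges hab hreg X
      have h2 := hin X
      simp only [sum_const, smul_eq_mul]
      omega)
  exact ⟨t, ht, fun v => le_antisymm (h v).2 (h v).1⟩

/-- Out-degrees `l, …, u` on one part of a partition and `4, 5, 6` on the other. -/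
lemma exists_isTail_partition (hab : ∀ e, a e ≠ b e)
    (hreg : ∀ v, (linkEdges a b v univ).card = 6) {l u : ℕ} (hlu : l ≤ 1 ∧ l < u) :
    ∃ t, IsTail a b t ∧ ∀ v, (l ≤ tailCount t v ∧ tailCount t v ≤ u) ∨
      (4 ≤ tailCount t v ∧ tailCount t v ≤ 6) := by
  obtain ⟨T, hT, hS⟩ := exists_partition hab hreg
  have bounds (X : Finset V) :
      (innerEdges a b X).card ≤ (X ∩ T).card + 6 * (X \ T).card ∧
      2 * (innerEdges a b X).card ≤ 12 * (X ∩ T).card + 3 * (X \ T).card := by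
    have h1 := card_innerEdges_le_inter_add hab hreg X T
    have h2 := card_innerEdges_le_inter_add hab hreg X Tᶜ
    have h3 := two_mul_card_innerEdges_le hab hT (inter_subset_right (s₁ := X))
    have h4 := two_mul_card_innerEdges_le hab hS (inter_subset_right (s₁ := X))
    have h5 : X ∩ Tᶜ = X \ T := by ext; simp
    have h6 : X \ Tᶜ = X ∩ T := by ext; simp
    rw [h5] at h4
    rw [h5, h6] at h2
    omega
  obtain ⟨t, ht, h⟩ := exists_isTail_bounds (a := a) (b := b)
    (fun v => if v ∈ T then l else 4) (fun v => if v ∈ T then u else 6)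
    (fun v => by split_ifs <;> omega)
    (fun X => by
      rw [sum_ite_mem_eq]
      have := (bounds X).1
      have := Nat.le_mul_of_pos_left (X ∩ T).card (show 0 < u by omega)
      omega)
    (fun X => by
      rw [sum_ite_mem_eq]
      have h1 := card_touching_add_card_innerEdges hab hreg X
      have h2 := card_innerEdges_le_three_mul hab hreg X
      have h3 := (bounds X).2
      have h4 := card_inter_add_card_sdiff X T
      have h5 := Nat.mul_le_mul_right (X ∩ T).card hlu.1
      omega)
  refine ⟨t, ht, fun v => ?_⟩
  have := h v
  by_cases hv : v ∈ T
  · simp only [hv, if_true] at this; exact Or.inl this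
  · simp only [hv, if_false] at this; exact Or.inr this

end Fintype

/-- Every parity assignment on `X` of the correct total is realised by out-degrees in the
subgraph induced on `X`. -/
def ParityRealizable (a b : E → V) (X : Finset V) : Prop :=
  ∀ p : V → ℕ, (∑ v ∈ X, p v) % 2 = (innerEdges a b X).card % 2 →
    ∃ t, IsTail a b t ∧ ∀ v ∈ X, ((innerEdges a b X).filter fun e => t e = v).card % 2 = p v % 2

lemma parityRealizable_singleton (hab : ∀ e, a e ≠ b e) (v : V) : ParityRealizable a b {v} := by
  have h0 : innerEdges a b {v} = ∅ := by
    ext e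
    have := hab e
    simp only [innerEdges, mem_filter, mem_univ, true_and, mem_singleton, notMem_empty]
    grind
  intro p hp
  refine ⟨a, fun e => Or.inl rfl, fun u hu => ?_⟩
  rw [mem_singleton] at hu
  subst hu
  rw [sum_singleton, h0] at hp
  rw [h0, hp]
  rfl

/-- Realising parities on `X` while prescribing the out-edges of one further vertex. -/
lemma ParityRealizable.exists_isTail_insert (hab : ∀ e, a e ≠ b e) {X : Finset V}
    (hX : ParityRealizable a b X) {v : V} (hv : v ∉ X) {O : Finset E}
    (hO : O ⊆ linkEdges a b v X) (p : V → ℕ)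
    (hp : (O.card + ∑ u ∈ X, p u) % 2 = (innerEdges a b (insert v X)).card % 2) :
    ∃ t, IsTail a b t ∧
      ((innerEdges a b (insert v X)).filter fun e => t e = v).card = O.card ∧
      ∀ u ∈ X, ((innerEdges a b (insert v X)).filter fun e => t e = u).card % 2 = p u % 2 := by
  let far : E → V := fun e => if a e = v then b e else a e
  let q : V → ℕ := fun u => ((linkEdges a b v X \ O).filter fun e => far e = u).card
  have hq : ∑ u ∈ X, q u = (linkEdges a b v X \ O).card := by
    symm
    refine card_eq_sum_card_fiberwise fun e he => ?_
    have he := (mem_sdiff.1 (mem_coe.1 he)).1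
    simp only [linkEdges, mem_filter, mem_univ, true_and] at he
    simp only [far, mem_coe]
    have := hab e
    grind
  have hc := card_innerEdges_insert hab hv
  have hsd := card_sdiff_add_card_eq_card hO
  obtain ⟨t, ht, htp⟩ := hX (fun u => p u + q u) (by rw [sum_add_distrib, hq]; omega)
  have hlink (e : E) : e ∈ linkEdges a b v X ↔ (a e = v ∧ b e ∈ X) ∨ (b e = v ∧ a e ∈ X) := by
    simp [linkEdges]
  have hinner (Y : Finset V) (e : E) : e ∈ innerEdges a b Y ↔ a e ∈ Y ∧ b e ∈ Y := by
    simp [innerEdges]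
  refine ⟨fun e => if e ∈ O then v else if e ∈ linkEdges a b v X then far e else t e,
    fun e => ?_, ?_, fun u hu => ?_⟩
  · have h1 := ht e
    have h2 := @hO e
    have h3 := hlink e
    simp only [far]
    grind
  · congr 1
    ext e
    have h1 := ht e
    have h2 := @hO e
    have h3 := hlink e
    have h4 := hab e
    simp only [far, mem_filter, hinner, mem_insert]
    grind
  · have huv : v ≠ u := fun h => hv (h ▸ hu)
    have h := htp u hu
    have key : ((innerEdges a b (insert v X)).filter fun e =>
        (if e ∈ O then v else if e ∈ linkEdges a b v X then far e else t e) = u).card =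
        ((innerEdges a b X).filter fun e => t e = u).card + q u := by
      rw [← card_union_of_disjoint]
      · congr 1
        ext e
        have h1 := ht e
        have h2 := @hO e
        have h3 := hlink e
        have h4 := hab e
        simp only [far, mem_filter, hinner, mem_insert, mem_union, mem_sdiff]
        grind
      · rw [disjoint_left]
        intro e
        simp only [mem_filter, hinner, mem_sdiff, hlink]
        grind
    rw [key]
    omega

lemma ParityRealizable.insert (hab : ∀ e, a e ≠ b e) {X : Finset V}
    (hX : ParityRealizable a b X) {v : V} (hv : v ∉ X)
    (hne : (linkEdges a b v X).Nonempty) : ParityRealizable a b (insert v X) := by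
  intro p hp
  rw [sum_insert hv] at hp
  obtain ⟨O, hO, hcard⟩ := exists_subset_card_eq
    (show p v % 2 ≤ (linkEdges a b v X).card by have := hne.card_pos; omega)
  obtain ⟨t, ht, h1, h2⟩ := hX.exists_isTail_insert hab hv hO p (by omega)
  refine ⟨t, ht, fun u hu => ?_⟩
  rcases mem_insert.1 hu with rfl | hu
  · omega
  · exact h2 u hu

variable [Fintype V]

/-- Every vertex lies in a union of components carrying an orientation in which each out-degree
is even, except possibly for one vertex of out-degree five. -/
lemma exists_closed_isTail (hab : ∀ e, a e ≠ b e)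
    (hreg : ∀ v, (linkEdges a b v univ).card = 6) (x : V) :
    ∃ S : Finset V, x ∈ S ∧ (∀ e, a e ∈ S ↔ b e ∈ S) ∧
      ∃ t, IsTail a b t ∧ ∀ v ∈ S, tailCount t v % 2 = 0 ∨ tailCount t v = 5 := by
  let Q : Finset V → Prop := fun S => x ∈ S ∧ ∃ v X, v ∉ X ∧ S = insert v X ∧
    ParityRealizable a b X ∧ (linkEdges a b v X).Nonempty
  have hQ : (univ.filter Q).Nonempty := by
    obtain ⟨e, he⟩ : (linkEdges a b x univ).Nonempty := by
      rw [← card_pos, hreg]; norm_num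
    simp only [linkEdges, mem_filter, mem_univ, true_and, and_true] at he
    have h := hab e
    rcases he with he | he
    · refine ⟨{b e, x}, mem_filter.2 ⟨mem_univ _, by simp, b e, {x}, by grind, rfl,
        parityRealizable_singleton hab x, e, ?_⟩⟩
      simp [linkEdges, he]
    · refine ⟨{a e, x}, mem_filter.2 ⟨mem_univ _, by simp, a e, {x}, by grind, rfl,
        parityRealizable_singleton hab x, e, ?_⟩⟩
      simp [linkEdges, he]
  obtain ⟨S, hS, hmax⟩ := exists_max_image _ card hQ
  obtain ⟨-, hxS, v, X, hv, rfl, hX, hne⟩ := mem_filter.1 hS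
  have hlink : ∀ w ∉ insert v X, linkEdges a b w (insert v X) = ∅ := by
    intro w hw
    by_contra hcon
    have := hmax (insert w (insert v X)) (mem_filter.2 ⟨mem_univ _, mem_insert_of_mem hxS,
      w, _, hw, rfl, hX.insert hab hv hne, nonempty_iff_ne_empty.2 hcon⟩)
    rw [card_insert_of_notMem hw] at this
    omega
  have hclosed : ∀ e, a e ∈ insert v X ↔ b e ∈ insert v X := by
    intro e
    constructor
    · intro h
      by_contra h'
      have : e ∈ linkEdges a b (b e) (insert v X) := by simp [linkEdges, mem_insert.1 h]
      simp [hlink _ h'] at this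
    · intro h
      by_contra h'
      have : e ∈ linkEdges a b (a e) (insert v X) := by simp [linkEdges, mem_insert.1 h]
      simp [hlink _ h'] at this
  have hsix : (linkEdges a b v X).card = 6 := by
    rw [← hreg v]
    congr 1
    ext e
    have h1 := hclosed e
    have h2 := hab e
    simp only [linkEdges, mem_filter, mem_univ, true_and]
    grind
  obtain ⟨O, hO, hcard⟩ := exists_subset_card_eq
    (show 6 - (innerEdges a b (insert v X)).card % 2 ≤ (linkEdges a b v X).card by omega)
  obtain ⟨t, ht, h1, h2⟩ := hX.exists_isTail_insert hab hv hO (fun _ => 0) (by simp; omega)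
  have hcount : ∀ u ∈ insert v X, tailCount t u =
      ((innerEdges a b (insert v X)).filter fun e => t e = u).card := by
    intro u hu
    rw [tailCount]
    congr 1
    ext e
    have h3 := hclosed e
    have h4 := ht e
    simp only [innerEdges, mem_filter, mem_univ, true_and]
    grind
  refine ⟨insert v X, hxS, hclosed, t, ht, fun u hu => ?_⟩
  rw [hcount u hu]
  rcases mem_insert.1 hu with rfl | hu
  · omega
  · exact Or.inl (h2 u hu)

theorem exists_isTail_even_or_five (hab : ∀ e, a e ≠ b e)
    (hreg : ∀ v, (linkEdges a b v univ).card = 6) :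
    ∃ t, IsTail a b t ∧ ∀ v, tailCount t v % 2 = 0 ∨ tailCount t v = 5 := by
  let Q : Finset V → Prop := fun U => (∀ e, a e ∈ U ↔ b e ∈ U) ∧
    ∃ t, IsTail a b t ∧ ∀ v ∈ U, tailCount t v % 2 = 0 ∨ tailCount t v = 5
  have hQ : (univ.filter Q).Nonempty :=
    ⟨∅, mem_filter.2 ⟨mem_univ _, by simp, a, fun e => Or.inl rfl, by simp⟩⟩
  obtain ⟨U, hU, hmax⟩ := exists_max_image _ card hQ
  obtain ⟨-, hclosed, t, ht, htU⟩ := mem_filter.1 hU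
  refine ⟨t, ht, fun x => htU x ?_⟩
  by_contra hx
  obtain ⟨S, hxS, hS, t', ht', htS⟩ := exists_closed_isTail hab hreg x
  let r : E → V := fun e => if a e ∈ U then t e else t' e
  have hle := hmax (U ∪ S) (mem_filter.2 ⟨mem_univ _, fun e => by
    rw [mem_union, mem_union, hclosed e, hS e], r, fun e => by
      have h1 := ht e
      have h2 := ht' e
      simp only [r]
      grind, fun v hv => by
      by_cases hvU : v ∈ U
      · have : tailCount r v = tailCount t v := by
          rw [tailCount, tailCount]
          congr 1
          ext e
          have h1 := ht e
          have h2 := ht' e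
          have h3 := hclosed e
          simp only [r, mem_filter, mem_univ, true_and]
          grind
        rw [this]
        exact htU v hvU
      · have : tailCount r v = tailCount t' v := by
          rw [tailCount, tailCount]
          congr 1
          ext e
          have h1 := ht e
          have h2 := ht' e
          have h3 := hclosed e
          simp only [r, mem_filter, mem_univ, true_and]
          grind
        rw [this]
        exact htS v ((mem_union.1 hv).resolve_left hvU)⟩)
  have : U ⊂ U ∪ S := ⟨subset_union_left, fun h => hx (h (mem_union_right _ hxS))⟩
  exact absurd (card_lt_card this) (by omega)

/-- The cases where the second forbidden value is below three. -/
lemma exists_isTail_avoiding_of_lt_three (hab : ∀ e, a e ≠ b e)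
    (hreg : ∀ v, (linkEdges a b v univ).card = 6) {c : ℕ} (hc : c < 3) :
    ∃ t, IsTail a b t ∧ ∀ v, tailCount t v ≠ 3 ∧ tailCount t v ≠ c := by
  interval_cases c
  · obtain ⟨t, ht, h⟩ := exists_isTail_partition hab hreg (l := 1) (u := 2) (by norm_num)
    exact ⟨t, ht, fun v => by have := h v; omega⟩
  · obtain ⟨t, ht, h⟩ := exists_isTail_even_or_five hab hreg
    exact ⟨t, ht, fun v => by have := h v; omega⟩
  · obtain ⟨t, ht, h⟩ := exists_isTail_partition hab hreg (l := 0) (u := 1) (by norm_num)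
    exact ⟨t, ht, fun v => by have := h v; omega⟩

lemma exists_isTail_tailCount_add_eq (hab : ∀ e, a e ≠ b e) {t : E → V} (ht : IsTail a b t) :
    ∃ t', IsTail a b t' ∧ ∀ v, tailCount t v + tailCount t' v = (linkEdges a b v univ).card := by
  refine ⟨fun e => if t e = a e then b e else a e, fun e => ?_, fun v => ?_⟩
  · dsimp only
    split_ifs <;> simp
  · rw [tailCount, tailCount, ← card_union_of_disjoint]
    · congr 1
      ext e
      have h1 := ht e
      have h2 := hab e
      simp only [linkEdges, mem_union, mem_filter, mem_univ, true_and, and_true]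
      grind
    · rw [disjoint_left]
      intro e
      have h1 := ht e
      have h2 := hab e
      simp only [mem_filter, mem_univ, true_and]
      grind

theorem exists_isTail_avoiding (hab : ∀ e, a e ≠ b e)
    (hreg : ∀ v, (linkEdges a b v univ).card = 6) {F : Finset ℕ} (hF : F.card ≤ 2) :
    ∃ t, IsTail a b t ∧ ∀ v, tailCount t v ∉ F := by
  by_cases h3 : 3 ∈ F
  swap
  · obtain ⟨t, ht, h⟩ := exists_isTail_eq_three hab hreg
    exact ⟨t, ht, fun v => by rwa [h v]⟩
  obtain ⟨c, hc3, hc⟩ : ∃ c, c ≠ 3 ∧ ∀ n ∈ F, n = 3 ∨ n = c := by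
    have h1 : (F.erase 3).card ≤ 1 := by rw [card_erase_of_mem h3]; omega
    rcases (F.erase 3).eq_empty_or_nonempty with h | ⟨c, hc⟩
    · exact ⟨0, by norm_num, fun n hn => Or.inl (by
        by_contra hne
        have := mem_erase.2 ⟨hne, hn⟩
        simp [h] at this)⟩
    · refine ⟨c, (mem_erase.1 hc).1, fun n hn => or_iff_not_imp_left.2 fun hne => ?_⟩
      exact card_le_one.1 h1 n (mem_erase.2 ⟨hne, hn⟩) c hc
  rcases lt_or_gt_of_ne hc3 with hlt | hgt
  · obtain ⟨t, ht, h⟩ := exists_isTail_avoiding_of_lt_three hab hreg hlt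
    exact ⟨t, ht, fun v hv => by have := h v; have := hc _ hv; omega⟩
  · obtain ⟨t, ht, h⟩ := exists_isTail_avoiding_of_lt_three hab hreg (c := min 2 (6 - c)) (by omega)
    obtain ⟨t', ht', h'⟩ := exists_isTail_tailCount_add_eq hab ht
    refine ⟨t', ht', fun v hv => ?_⟩
    have h1 := h v
    have h2 := hc _ hv
    have h3 := h' v
    rw [hreg] at h3
    omega

end Ends

end Multigraph

/-- every 6-regular graph and `F ⊆ {0,…,6}` with `|F| ≤ 2` admits an
`F`-avoiding orientation. -/
theorem stmt18 {V E : Type} [Fintype E] (G : Multigraph V E)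
    (hreg : ∀ v, G.deg v = 6)
    (F : Finset ℕ) (hFsub : F ⊆ Finset.range 7) (hF : F.card ≤ 2) :
    ∃ D : G.Orientation, ∀ v, D.outDeg v ∉ F := by
  have hends : ∀ e, ∃ p : V × V, G.ends e = s(p.1, p.2) := fun e => by
    induction h : G.ends e with | _ x y => exact ⟨(x, y), rfl⟩
  choose f hf using hends
  have hab : ∀ e, (f e).1 ≠ (f e).2 := fun e h => by
    have := G.loopless e
    rw [hf e, Sym2.mk_isDiag_iff] at this
    exact this h
  have hmem : ∀ v, ∃ e, v ∈ G.ends e := fun v => by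
    have h : 0 < G.deg v := by rw [hreg]; norm_num
    obtain ⟨e, he⟩ := card_pos.1 h
    exact ⟨e, (mem_filter.1 he).2⟩
  have : Finite V := Finite.of_surjective
    (Sum.elim (fun e => (f e).1) (fun e => (f e).2) : E ⊕ E → V) fun v => by
      obtain ⟨e, he⟩ := hmem v
      rw [hf e, Sym2.mem_iff] at he
      rcases he with he | he
      · exact ⟨Sum.inl e, he.symm⟩
      · exact ⟨Sum.inr e, he.symm⟩
  have := Fintype.ofFinite V
  have hdeg : ∀ v, (Multigraph.linkEdges (fun e => (f e).1) (fun e => (f e).2) v univ).card = 6 := by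
    intro v
    rw [← hreg v, Multigraph.deg]
    congr 1
    ext e
    simp only [Multigraph.linkEdges, mem_filter, mem_univ, true_and, and_true, hf e, Sym2.mem_iff]
    grind
  obtain ⟨t, ht, h⟩ := Multigraph.exists_isTail_avoiding hab hdeg hF
  refine ⟨⟨t, fun e => if t e = (f e).1 then (f e).2 else (f e).1, fun e => ?_⟩, h⟩
  rw [hf e]
  rcases ht e with he | he
  · simp [he]
  · rw [if_neg (by rw [he]; exact (hab e).symm), he, Sym2.eq_swap]
end
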